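/- Let ω ∈ [3/4, ½(1 + 1/√2)] and set R = √2·(2ω − 1), θ = 0, δ = R²/4, α₀ = 0, α₁ = π/4, β₀ = π/8, β₁ = −π/8, and let λ₀, λ₁, λ₂, λ₃ be given by the Bell-diagonal parameterization with these values of R, θ, δ. Then: (i) the CHSH score satisfies S(R, θ, α₀, α₁, β₀, β₁) = ω, and in fact ε_{xy} = ω/2 for all x, y ∈ {0,1}; and (ii) 1 + ¼·(H_bin(2ε₀₀) + H_bin(2ε₀₁) + H_bin(2ε₁₀) + H_bin(2ε₁₁)) − H(λ₀, λ₁, λ₂, λ₃) = 1 + H_bin(ω) − 2·H_bin(½ + (2ω − 1)/√2). -/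

import Mathlib

open Real

/-- `ent x = -x·log₂ x`, with the convention `0·log₂ 0 = 0`. -/
noncomputable def ent (x : ℝ) : ℝ := -(x * Real.logb 2 x)

/-- Shannon entropy (base 2) of a probability vector of length 4. -/
noncomputable def H4 (a b c d : ℝ) : ℝ := ent a + ent b + ent c + ent d

/-- Binary entropy (base 2). -/
noncomputable def Hbin (p : ℝ) : ℝ := ent p + ent (1 - p)

noncomputable def lam0 (R θ δ : ℝ) : ℝ := 1 / 4 + R * Real.cos θ / 2 + δ
noncomputable def lam1 (R θ δ : ℝ) : ℝ := 1 / 4 + R * Real.sin θ / 2 - δ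
noncomputable def lam2 (R θ δ : ℝ) : ℝ := 1 / 4 - R * Real.sin θ / 2 - δ
noncomputable def lam3 (R θ δ : ℝ) : ℝ := 1 / 4 - R * Real.cos θ / 2 + δ

noncomputable def eps00 (R θ a0 a1 b0 b1 : ℝ) : ℝ :=
  (1 + R * Real.cos θ * Real.cos (2 * (a0 - b0))
     + R * Real.sin θ * Real.cos (2 * (a0 + b0))) / 4

noncomputable def eps01 (R θ a0 a1 b0 b1 : ℝ) : ℝ :=
  (1 + R * Real.cos θ * Real.cos (2 * (a0 - b1))
     + R * Real.sin θ * Real.cos (2 * (a0 + b1))) / 4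

noncomputable def eps10 (R θ a0 a1 b0 b1 : ℝ) : ℝ :=
  (1 + R * Real.cos θ * Real.cos (2 * (a1 - b0))
     + R * Real.sin θ * Real.cos (2 * (a1 + b0))) / 4

noncomputable def eps11 (R θ a0 a1 b0 b1 : ℝ) : ℝ :=
  (1 - R * Real.cos θ * Real.cos (2 * (a1 - b1))
     - R * Real.sin θ * Real.cos (2 * (a1 + b1))) / 4

/-- CHSH score of the qubit strategy. -/
noncomputable def chshS (R θ a0 a1 b0 b1 : ℝ) : ℝ :=
  (eps00 R θ a0 a1 b0 b1 + eps01 R θ a0 a1 b0 b1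
    + eps10 R θ a0 a1 b0 b1 + eps11 R θ a0 a1 b0 b1) / 2

/-- The value `R = √2(2ω−1)` used in the explicit strategy. -/
noncomputable def Rg (ω : ℝ) : ℝ := Real.sqrt 2 * (2 * ω - 1)

theorem ent_mul (p q : ℝ) : ent (p * q) = p * ent q + q * ent p := by
  unfold ent
  rcases eq_or_ne p 0 with rfl | hp
  · simp
  rcases eq_or_ne q 0 with rfl | hq
  · simp
  rw [Real.logb_mul hp hq]
  ring

/-- The entropy of two independent copies of a binary distribution is twice its entropy. -/
theorem H4_mul (p : ℝ) :
    H4 (p * p) (p * (1 - p)) (p * (1 - p)) ((1 - p) * (1 - p)) = 2 * Hbin p := by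
  simp only [H4, Hbin, ent_mul]
  ring

theorem H4_lam_eq_two_mul_Hbin (R : ℝ) :
    H4 (lam0 R 0 (R ^ 2 / 4)) (lam1 R 0 (R ^ 2 / 4)) (lam2 R 0 (R ^ 2 / 4))
      (lam3 R 0 (R ^ 2 / 4)) = 2 * Hbin (1 / 2 + R / 2) := by
  rw [← H4_mul]
  simp only [lam0, lam1, lam2, lam3, Real.cos_zero, Real.sin_zero]
  congr 1 <;> ring

theorem Rg_mul_sqrt_two_div_two (ω : ℝ) : Rg ω * (√2 / 2) = 2 * ω - 1 := by
  have h : √2 * √2 = 2 := Real.mul_self_sqrt (by norm_num)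
  unfold Rg
  linear_combination (2 * ω - 1) / 2 * h

theorem Rg_div_two (ω : ℝ) : Rg ω / 2 = (2 * ω - 1) / √2 := by
  have h : √2 * √2 = 2 := Real.mul_self_sqrt (by norm_num)
  rw [eq_div_iff (by positivity), ← Rg_mul_sqrt_two_div_two]
  ring

/-- The explicit strategy `R = √2(2ω−1), θ = 0, δ = R²/4, α₀ = 0, α₁ = π/4,
β₀ = π/8, β₁ = −π/8` achieves CHSH score `ω` (indeed `ε_{xy} = ω/2` for all
`x,y`) and its entropy expression evaluates to
`1 + H_bin(ω) − 2·H_bin(½ + (2ω−1)/√2)`. -/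
theorem explicit_strategy_entropy (ω : ℝ)
    (hω1 : 3 / 4 ≤ ω) (hω2 : ω ≤ (1 + 1 / Real.sqrt 2) / 2) :
    chshS (Rg ω) 0 0 (π / 4) (π / 8) (-(π / 8)) = ω ∧
    eps00 (Rg ω) 0 0 (π / 4) (π / 8) (-(π / 8)) = ω / 2 ∧
    eps01 (Rg ω) 0 0 (π / 4) (π / 8) (-(π / 8)) = ω / 2 ∧
    eps10 (Rg ω) 0 0 (π / 4) (π / 8) (-(π / 8)) = ω / 2 ∧
    eps11 (Rg ω) 0 0 (π / 4) (π / 8) (-(π / 8)) = ω / 2 ∧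
    1 + (Hbin (2 * eps00 (Rg ω) 0 0 (π / 4) (π / 8) (-(π / 8)))
          + Hbin (2 * eps01 (Rg ω) 0 0 (π / 4) (π / 8) (-(π / 8)))
          + Hbin (2 * eps10 (Rg ω) 0 0 (π / 4) (π / 8) (-(π / 8)))
          + Hbin (2 * eps11 (Rg ω) 0 0 (π / 4) (π / 8) (-(π / 8)))) / 4
      - H4 (lam0 (Rg ω) 0 (Rg ω ^ 2 / 4)) (lam1 (Rg ω) 0 (Rg ω ^ 2 / 4))
           (lam2 (Rg ω) 0 (Rg ω ^ 2 / 4)) (lam3 (Rg ω) 0 (Rg ω ^ 2 / 4))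
      = 1 + Hbin ω - 2 * Hbin (1 / 2 + (2 * ω - 1) / Real.sqrt 2) := by
  have hR := Rg_mul_sqrt_two_div_two ω
  have h00 : eps00 (Rg ω) 0 0 (π / 4) (π / 8) (-(π / 8)) = ω / 2 := by
    rw [eps00, show 2 * (0 - π / 8) = -(π / 4) by ring, Real.cos_neg, Real.cos_pi_div_four,
      Real.cos_zero, Real.sin_zero]
    linear_combination hR / 4
  have h01 : eps01 (Rg ω) 0 0 (π / 4) (π / 8) (-(π / 8)) = ω / 2 := by
    rw [eps01, show 2 * (0 - -(π / 8)) = π / 4 by ring, Real.cos_pi_div_four,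
      Real.cos_zero, Real.sin_zero]
    linear_combination hR / 4
  have h10 : eps10 (Rg ω) 0 0 (π / 4) (π / 8) (-(π / 8)) = ω / 2 := by
    rw [eps10, show 2 * (π / 4 - π / 8) = π / 4 by ring, Real.cos_pi_div_four,
      Real.cos_zero, Real.sin_zero]
    linear_combination hR / 4
  have h11 : eps11 (Rg ω) 0 0 (π / 4) (π / 8) (-(π / 8)) = ω / 2 := by
    rw [eps11, show 2 * (π / 4 - -(π / 8)) = π - π / 4 by ring, Real.cos_pi_sub,
      Real.cos_pi_div_four, Real.cos_zero, Real.sin_zero]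
    linear_combination hR / 4
  refine ⟨?_, h00, h01, h10, h11, ?_⟩
  · rw [chshS, h00, h01, h10, h11]
    ring
  · rw [h00, h01, h10, h11, H4_lam_eq_two_mul_Hbin, Rg_div_two, show 2 * (ω / 2) = ω by ring]
    ring
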